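/- Let n ≥ 2 and m ≥ 1 be integers, let K be an algebraically closed field, and let p(x_1,…,x_m) be a polynomial with zero constant term in the free algebra K⟨x_1,…,x_m⟩. Set r = ord(p) and suppose 1 < r < n−1. Then the image p(T_n(K)) = {p(u_1,…,u_m) : u_1,…,u_m ∈ T_n(K)} is a Zariski-dense subset of T_n(K)^{(r−1)}; equivalently, every polynomial function on T_n(K)^{(r−1)} (viewed as the affine space K^d with d = (n−r)(n−r+1)/2 via its possibly nonzero entries) that vanishes on p(T_n(K)) vanishes identically on T_n(K)^{(r−1)}. -/

import Mathlib

/-- polynomial identity of `T_s` -/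
def IsIdT {K : Type*} [Field K] {m : ℕ} (s : ℕ) (q : FreeAlgebra K (Fin m)) : Prop :=
  ∀ u : Fin m → Matrix (Fin s) (Fin s) K,
      (∀ i, (u i).BlockTriangular id) → FreeAlgebra.lift K u q = 0

section
variable {K : Type*} [Field K] {m : ℕ}

lemma lift_tri {n : ℕ} (u : Fin m → Matrix (Fin n) (Fin n) K)
    (hu : ∀ i, (u i).BlockTriangular id) (q : FreeAlgebra K (Fin m)) :
    (FreeAlgebra.lift K u q).BlockTriangular id := by
  induction q using FreeAlgebra.induction with
  | grade0 r =>
    rw [AlgHom.commutes, Matrix.algebraMap_eq_diagonal]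
    exact Matrix.blockTriangular_diagonal _
  | grade1 x => simpa using hu x
  | mul a b ha hb => rw [map_mul]; exact ha.mul hb
  | add a b ha hb => rw [map_add]; exact ha.add hb

lemma lift_window {n t a : ℕ} (e : Fin t → Fin n) (he : ∀ i, (e i : ℕ) = a + i)
    (u : Fin m → Matrix (Fin n) (Fin n) K)
    (hu : ∀ i, (u i).BlockTriangular id) (q : FreeAlgebra K (Fin m)) :
    ∀ i j, FreeAlgebra.lift K u q (e i) (e j) =
      FreeAlgebra.lift K (fun c => (u c).submatrix e e) q i j := by
  have hinj : Function.Injective e := fun x y h => by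
    have := congrArg Fin.val h
    rw [he, he] at this
    exact Fin.ext (by omega)
  induction q using FreeAlgebra.induction with
  | grade0 r =>
    intro i j
    simp [AlgHom.commutes, Matrix.algebraMap_matrix_apply, hinj.eq_iff]
  | grade1 x => simp
  | mul x y hx hy =>
    intro i j
    rw [map_mul, map_mul, Matrix.mul_apply, Matrix.mul_apply]
    simp_rw [← hx, ← hy]
    symm
    apply Finset.sum_of_injOn e hinj.injOn (by simp)
    · intro k _ hk
      by_cases h1 : k < e i
      · rw [lift_tri u hu x h1, zero_mul]
      by_cases h2 : e j < k
      · rw [lift_tri u hu y h2, mul_zero]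
      exfalso
      apply hk
      rw [Fin.lt_def, he] at h1 h2
      have := j.2
      refine ⟨⟨k - a, by omega⟩, by simp, Fin.ext ?_⟩
      rw [he]; simp; omega
    · simp
  | add x y hx hy => intro i j; simp [hx, hy]

lemma exists_pad {n t a : ℕ} (e : Fin t → Fin n) (he : ∀ i, (e i : ℕ) = a + i)
    (v : Fin m → Matrix (Fin t) (Fin t) K) (hv : ∀ i, (v i).BlockTriangular id) :
    ∃ u : Fin m → Matrix (Fin n) (Fin n) K, (∀ i, (u i).BlockTriangular id) ∧
      (fun c => (u c).submatrix e e) = v := by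
  refine ⟨fun c => Matrix.of fun i j => if h : (a ≤ i ∧ (i : ℕ) < a + t) ∧ (a ≤ j ∧ (j : ℕ) < a + t) then
      v c ⟨i - a, by omega⟩ ⟨j - a, by omega⟩ else 0, ?_, ?_⟩
  · intro c i j hij
    simp only [Matrix.of_apply]
    split_ifs with h
    · apply hv
      simp only [id, Fin.lt_def] at hij ⊢
      omega
    · rfl
  · funext c i j
    simp [he]

lemma IsIdT.mono {s t : ℕ} (hts : t ≤ s) {q : FreeAlgebra K (Fin m)} (h : IsIdT s q) :
    IsIdT t q := by
  intro v hv
  have he : ∀ i, (Fin.castLE hts i : ℕ) = 0 + i := by simp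
  obtain ⟨u, hu, huv⟩ := exists_pad (Fin.castLE hts) he v hv
  ext i j
  rw [← huv, ← lift_window _ he u hu, h u hu]
  simp

lemma IsIdT.vanish {n s : ℕ} {q : FreeAlgebra K (Fin m)} (h : IsIdT s q)
    (u : Fin m → Matrix (Fin n) (Fin n) K) (hu : ∀ i, (u i).BlockTriangular id)
    (i j : Fin n) (hij : (j : ℕ) < i + s) : FreeAlgebra.lift K u q i j = 0 := by
  by_cases hji : j < i
  · exact lift_tri u hu q hji
  rw [Fin.lt_def] at hji
  let e : Fin (j - i + 1) → Fin n := fun k => ⟨i + k, by omega⟩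
  have he : ∀ k, (e k : ℕ) = i + k := fun k => rfl
  have h1 : e ⟨0, by omega⟩ = i := Fin.ext (by simp [he])
  have h2 : e ⟨j - i, by omega⟩ = j := Fin.ext (by simp [he]; omega)
  have := lift_window e he u hu q ⟨0, by omega⟩ ⟨j - i, by omega⟩
  rw [h1, h2] at this
  have ht : ∀ c, ((u c).submatrix e e).BlockTriangular id := fun c k l hkl => hu c (by
    simp only [id, Fin.lt_def, he] at hkl ⊢; omega)
  have hz := h.mono (show (j : ℕ) - i + 1 ≤ s by omega) (fun c => (u c).submatrix e e) ht
  rw [this, hz]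
  rfl

lemma IsIdT.nonvanish {s : ℕ} {q : FreeAlgebra K (Fin m)} (h : IsIdT s q)
    (h1 : ¬ IsIdT (s + 1) q) : ∃ u : Fin m → Matrix (Fin (s + 1)) (Fin (s + 1)) K,
      (∀ i, (u i).BlockTriangular id) ∧ FreeAlgebra.lift K u q 0 (Fin.last s) ≠ 0 := by
  unfold IsIdT at h1
  push Not at h1
  obtain ⟨u, hu, hne⟩ := h1
  refine ⟨u, hu, fun h0 => hne ?_⟩
  ext i j
  by_cases hij : (j : ℕ) < i + s
  · exact h.vanish u hu i j hij
  · have hi : i = 0 := Fin.ext (by rw [Fin.val_zero]; omega)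
    have hj : j = Fin.last s := Fin.ext (by simp; omega)
    rw [hi, hj, h0]; rfl

lemma exists_deriv (l : Fin m → K) (p : FreeAlgebra K (Fin m)) :
    ∃ q : Fin m → FreeAlgebra K (Fin m), ∀ (n : ℕ)
      (U : Fin m → Matrix (Fin (n + 1)) (Fin (n + 1)) K),
      (∀ c i, U c (Fin.succ i) 0 = 0) → (∀ c, U c 0 0 = l c) →
      (∀ i, FreeAlgebra.lift K U p (Fin.succ i) 0 = 0) ∧
      FreeAlgebra.lift K U p 0 0 = FreeAlgebra.lift K l p ∧
      (∀ i j, FreeAlgebra.lift K U p (Fin.succ i) (Fin.succ j) =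
        FreeAlgebra.lift K (fun c => (U c).submatrix Fin.succ Fin.succ) p i j) ∧
      (∀ j, FreeAlgebra.lift K U p 0 (Fin.succ j) = ∑ c, ∑ k, U c 0 (Fin.succ k) *
        FreeAlgebra.lift K (fun c => (U c).submatrix Fin.succ Fin.succ) (q c) k j) := by
  induction p using FreeAlgebra.induction with
  | grade0 r =>
    refine ⟨fun _ => 0, fun n U h1 h2 => ?_⟩
    simp [AlgHom.commutes, Matrix.algebraMap_matrix_apply, (Fin.succ_ne_zero _).symm]
  | grade1 x =>
    refine ⟨fun c => if c = x then 1 else 0, fun n U h1 h2 => ?_⟩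
    refine ⟨by simp [h1], by simp [h2], by simp, fun j => ?_⟩
    rw [Finset.sum_eq_single x]
    · simp [Matrix.one_apply]
    · intro b _ hb; simp [hb]
    · simp
  | add a b ha hb =>
    obtain ⟨qa, ha⟩ := ha
    obtain ⟨qb, hb⟩ := hb
    refine ⟨fun c => qa c + qb c, fun n U h1 h2 => ?_⟩
    obtain ⟨a1, a2, a3, a4⟩ := ha n U h1 h2
    obtain ⟨b1, b2, b3, b4⟩ := hb n U h1 h2
    simp [a1, a2, a3, a4, b1, b2, b3, b4, mul_add, Finset.sum_add_distrib]
  | mul a b ha hb =>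
    obtain ⟨qa, ha⟩ := ha
    obtain ⟨qb, hb⟩ := hb
    refine ⟨fun c => FreeAlgebra.lift K l a • qb c + qa c * b, fun n U h1 h2 => ?_⟩
    obtain ⟨a1, a2, a3, a4⟩ := ha n U h1 h2
    obtain ⟨b1, b2, b3, b4⟩ := hb n U h1 h2
    refine ⟨?_, ?_, ?_, ?_⟩
    · intro i; simp [Matrix.mul_apply, Fin.sum_univ_succ, a1, b1]
    · simp [Matrix.mul_apply, Fin.sum_univ_succ, a2, b2, b1]
    · intro i j; simp [Matrix.mul_apply, Fin.sum_univ_succ, a1, a3, b3]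
    · intro j
      simp only [map_mul, map_add, map_smul, Matrix.mul_apply, Fin.sum_univ_succ, a2, b3, a4, b4,
        Matrix.add_apply, Matrix.smul_apply, mul_add, Finset.sum_add_distrib, Finset.mul_sum,
        Finset.sum_mul, smul_eq_mul]
      congr 1
      · refine Finset.sum_congr rfl fun c _ => Finset.sum_congr rfl fun k _ => by ring
      · rw [Finset.sum_comm]
        refine Finset.sum_congr rfl fun c _ => ?_
        rw [Finset.sum_comm]
        refine Finset.sum_congr rfl fun c _ => Finset.sum_congr rfl fun k _ => by ring

/-- triangular matrices from parameters -/
def triOf {n : ℕ} (x : Fin m × Fin n × Fin n → K) (c : Fin m) : Matrix (Fin n) (Fin n) K :=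
  fun i j => if i ≤ j then x (c, i, j) else 0

lemma triOf_tri {n : ℕ} (x : Fin m × Fin n × Fin n → K) (c : Fin m) :
    (triOf x c).BlockTriangular id := by
  intro i j hij
  exact if_neg (not_le.mpr hij)

lemma exists_triOf {n : ℕ} (u : Fin m → Matrix (Fin n) (Fin n) K)
    (hu : ∀ i, (u i).BlockTriangular id) : ∃ x, triOf x = u := by
  refine ⟨fun y => u y.1 y.2.1 y.2.2, ?_⟩
  funext c i j
  unfold triOf
  split_ifs with h
  · rfl
  · exact (hu c (not_le.mp h)).symm

lemma exists_poly {n : ℕ} (q : FreeAlgebra K (Fin m)) :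
    ∃ G : Fin n → Fin n → MvPolynomial (Fin m × Fin n × Fin n) K,
      ∀ x i j, MvPolynomial.eval x (G i j) = FreeAlgebra.lift K (triOf x) q i j := by
  induction q using FreeAlgebra.induction with
  | grade0 r =>
    refine ⟨fun i j => if i = j then MvPolynomial.C r else 0, fun x i j => ?_⟩
    rw [AlgHom.commutes, Matrix.algebraMap_matrix_apply]
    by_cases h : i = j <;> simp [h]
  | grade1 c =>
    refine ⟨fun i j => if i ≤ j then MvPolynomial.X (c, i, j) else 0, fun x i j => ?_⟩
    rw [FreeAlgebra.lift_ι_apply, triOf]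
    by_cases h : i ≤ j <;> simp [h]
  | add a b ha hb =>
    obtain ⟨qa, ha⟩ := ha
    obtain ⟨qb, hb⟩ := hb
    exact ⟨fun i j => qa i j + qb i j, fun x i j => by simp [ha, hb]⟩
  | mul a b ha hb =>
    obtain ⟨qa, ha⟩ := ha
    obtain ⟨qb, hb⟩ := hb
    exact ⟨fun i j => ∑ k, qa i k * qb k j, fun x i j => by simp [ha, hb, Matrix.mul_apply]⟩

/-- solving the triangular system -/
lemma exists_row {n s : ℕ} (M : Matrix (Fin n) (Fin n) K)
    (h0 : ∀ i j : Fin n, (j : ℕ) < i + s → M i j = 0)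
    (h1 : ∀ i j : Fin n, (j : ℕ) = i + s → M i j ≠ 0) (v : Fin n → K) :
    ∃ w : Fin n → K, ∀ j : Fin n, s ≤ j → ∑ k, w k * M k j = v j := by
  let N : Matrix (Fin n) (Fin n) K := fun k l =>
    if h : l + s < n then M k ⟨l + s, h⟩ else if k = l then 1 else 0
  have htri : N.BlockTriangular id := by
    intro k l hkl
    simp only [id, Fin.lt_def] at hkl
    simp only [N]
    split_ifs with h h'
    · apply h0; simp; omega
    · subst h'; omega
    · rfl
  have hdet : IsUnit N.det := by
    rw [Matrix.det_of_isUpperTriangular htri, isUnit_iff_ne_zero, Finset.prod_ne_zero_iff]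
    intro k _
    simp only [N]
    split_ifs with h
    · exact h1 _ _ rfl
    · exact one_ne_zero
  let v' : Fin n → K := fun l => if h : l + s < n then v ⟨l + s, h⟩ else 0
  refine ⟨Matrix.vecMul v' N⁻¹, fun j hj => ?_⟩
  have := congrFun (show Matrix.vecMul (Matrix.vecMul v' N⁻¹) N = v' by
    rw [Matrix.vecMul_vecMul, Matrix.nonsing_inv_mul _ hdet, Matrix.vecMul_one])
    ⟨j - s, by omega⟩
  have hlt : (j : ℕ) - s + s < n := by omega
  have hj' : (⟨(j : ℕ) - s + s, hlt⟩ : Fin n) = j := Fin.ext (by simp; omega)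
  have hv' : v' ⟨j - s, by omega⟩ = v j := by simp only [v', hlt, dite_true, hj']
  have hN : ∀ k, N k ⟨j - s, by omega⟩ = M k j := fun k => by
    simp only [N, hlt, dite_true, hj']
  rw [hv'] at this
  rw [← this]
  conv_rhs => rw [Matrix.vecMul, dotProduct]
  simp only [hN]

lemma dense_aux [Infinite K] (s : ℕ) (p : FreeAlgebra K (Fin m)) (hp : IsIdT (s + 1) p)
    (hp1 : ¬ IsIdT (s + 2) p) (n : ℕ) :
    ∀ (f : MvPolynomial {q : Fin n × Fin n // (q.1 : ℕ) + (s + 1) ≤ (q.2 : ℕ)} K)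
      (v : {q : Fin n × Fin n // (q.1 : ℕ) + (s + 1) ≤ (q.2 : ℕ)} → K),
      MvPolynomial.eval v f ≠ 0 →
      ∃ u : Fin m → Matrix (Fin n) (Fin n) K, (∀ i, (u i).BlockTriangular id) ∧
        MvPolynomial.eval (fun q => (FreeAlgebra.lift K u p) q.1.1 q.1.2) f ≠ 0 := by
  -- derivative
  obtain ⟨U, hU, hUne⟩ := hp.nonvanish hp1
  obtain ⟨q, hq⟩ := exists_deriv (fun c => U c 0 0) p
  have hbot : ∀ c i, U c (Fin.succ i) 0 = 0 := fun c i => hU c (Fin.succ_pos i)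
  have hU' : ∀ c, ((U c).submatrix Fin.succ Fin.succ).BlockTriangular id :=
    fun c i j hij => hU c (Fin.succ_lt_succ_iff.mpr hij)
  obtain ⟨-, -, -, hrow⟩ := hq _ U hbot (fun _ => rfl)
  have h1 : ∃ c, ¬ IsIdT (s + 1) (q c) := by
    by_contra! hall
    apply hUne
    rw [← Fin.succ_last, hrow]
    refine Finset.sum_eq_zero fun c _ => Finset.sum_eq_zero fun k _ => ?_
    rw [hall c _ hU']
    simp
  obtain ⟨c, hc⟩ := h1
  -- block matrices
  let blk : ∀ {t : ℕ}, (Fin t → K) → (Fin m → Matrix (Fin t) (Fin t) K) → Fin m →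
      Matrix (Fin (t + 1)) (Fin (t + 1)) K := fun {t} w u d =>
    Fin.cons (Fin.cons (U d 0 0) (if d = c then w else 0)) (fun i => Fin.cons 0 (u d i))
  have blk_sub : ∀ {t : ℕ} (w : Fin t → K) u, (fun d => (blk w u d).submatrix Fin.succ Fin.succ) = u := by
    intro t w u; funext d i j; rw [Matrix.submatrix_apply]; simp [blk]
  have blk_tri : ∀ {t : ℕ} (w : Fin t → K) u, (∀ d, (u d).BlockTriangular id) →
      ∀ d, (blk w u d).BlockTriangular id := by
    intro t w u hu d i j
    refine Fin.cases ?_ (fun i => ?_) i <;> refine Fin.cases ?_ (fun j => ?_) j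
    · intro h; simp at h
    · intro h; exact absurd h (by simp)
    · intro h; simp [blk]
    · intro h
      simp only [blk, Fin.cons_succ]
      exact hu d (Fin.succ_lt_succ_iff.mp h)
  have blk_eval : ∀ {t : ℕ} (w : Fin t → K) u,
      (∀ i j, FreeAlgebra.lift K (blk w u) p (Fin.succ i) (Fin.succ j) =
        FreeAlgebra.lift K u p i j) ∧
      (∀ j, FreeAlgebra.lift K (blk w u) p 0 (Fin.succ j) =
        ∑ k, w k * FreeAlgebra.lift K u (q c) k j) := by
    intro t w u
    obtain ⟨-, -, h3, h4⟩ := hq _ (blk w u) (by simp [blk]) (by simp [blk])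
    rw [blk_sub] at h3 h4
    refine ⟨h3, fun j => ?_⟩
    rw [h4, Finset.sum_eq_single c]
    · simp [blk]
    · intro b _ hb; simp [blk, hb]
    · simp
  have hqid : IsIdT s (q c) := by
    intro u hu
    ext k j
    have h := (blk_eval (Pi.single k 1) u).2 j
    rw [hp _ (blk_tri _ u hu)] at h
    simp [Pi.single_apply] at h
    simpa using h.symm
  obtain ⟨V, hV, hVne⟩ := hqid.nonvanish hc
  induction n with
  | zero =>
    intro f v hv
    refine ⟨fun _ => 0, fun i => Matrix.blockTriangular_zero, ?_⟩
    convert hv using 3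
    funext x
    exact x.1.1.elim0
  | succ n ih =>
    intro f v hv
    let v' : {q : Fin n × Fin n // (q.1 : ℕ) + (s + 1) ≤ (q.2 : ℕ)} → K :=
      fun y => v ⟨(y.1.1.succ, y.1.2.succ), by have := y.2; simp; omega⟩
    let sub : {q : Fin (n+1) × Fin (n+1) // (q.1 : ℕ) + (s + 1) ≤ (q.2 : ℕ)} →
        MvPolynomial {q : Fin n × Fin n // (q.1 : ℕ) + (s + 1) ≤ (q.2 : ℕ)} K := fun y =>
      if h : (y.1.1 : ℕ) = 0 then MvPolynomial.C (v y) else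
        MvPolynomial.X ⟨(⟨y.1.1 - 1, by omega⟩, ⟨y.1.2 - 1, by have := y.2; omega⟩), by
          have := y.2; simp; omega⟩
    let f' := MvPolynomial.bind₁ sub f
    have hf' : ∀ z, MvPolynomial.eval z f' =
        MvPolynomial.eval (fun y => MvPolynomial.eval z (sub y)) f := by
      intro z
      simp only [f', MvPolynomial.eval, MvPolynomial.eval₂Hom_bind₁]
    obtain ⟨u1, hu1, hu1ne⟩ := ih f' v' (by
      rw [hf']
      convert hv using 3
      funext y
      simp only [sub]
      split_ifs with h
      · simp
      · simp only [MvPolynomial.eval_X, v']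
        congr 1
        have := y.2
        refine Subtype.ext (Prod.ext (Fin.ext ?_) (Fin.ext ?_)) <;> simp <;> omega)
    obtain ⟨x1, rfl⟩ := exists_triOf u1 hu1
    obtain ⟨P, hP⟩ := exists_poly (n := n) p
    obtain ⟨Q, hQ⟩ := exists_poly (n := n) (q c)
    let G1 := MvPolynomial.bind₁ (fun y : {q : Fin n × Fin n // (q.1 : ℕ) + (s + 1) ≤ (q.2 : ℕ)} =>
      P y.1.1 y.1.2) f'
    have hG1 : ∀ x, MvPolynomial.eval x G1 = MvPolynomial.eval
        (fun y => (FreeAlgebra.lift K (triOf x) p) y.1.1 y.1.2) f' := by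
      intro x
      simp only [← hP]
      simp only [G1, MvPolynomial.eval, MvPolynomial.eval₂Hom_bind₁]
    have hG1ne : G1 ≠ 0 := by
      intro h
      apply hu1ne
      rw [← hG1, h, map_zero]
    have hQne : ∀ i j : Fin n, (j : ℕ) = i + s → Q i j ≠ 0 := by
      intro i j hij h
      let e : Fin (s + 1) → Fin n := fun k => ⟨i + k, by omega⟩
      have he : ∀ k, (e k : ℕ) = i + k := fun k => rfl
      obtain ⟨u, hu, huV⟩ := exists_pad e he V hV
      have hw := lift_window e he u hu (q c) 0 (Fin.last s)
      rw [huV] at hw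
      rw [← hw] at hVne
      obtain ⟨x, rfl⟩ := exists_triOf u hu
      rw [← hQ] at hVne
      have e1 : e 0 = i := Fin.ext (by simp [he])
      have e2 : e (Fin.last s) = j := Fin.ext (by simp [he, hij])
      rw [e1, e2, h, map_zero] at hVne
      exact hVne rfl
    let H := G1 * ∏ i : Fin n, ∏ j : Fin n, if (j : ℕ) = i + s then Q i j else 1
    have hH : H ≠ 0 := by
      refine mul_ne_zero hG1ne ?_
      rw [Finset.prod_ne_zero_iff]
      intro i _
      rw [Finset.prod_ne_zero_iff]
      intro j _
      split_ifs with h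
      · exact hQne i j h
      · exact one_ne_zero
    obtain ⟨x, hx⟩ : ∃ x, MvPolynomial.eval x H ≠ 0 := by
      by_contra! hall
      exact hH (MvPolynomial.funext (fun x => by rw [hall, map_zero]))
    simp only [H, map_mul, map_prod] at hx
    obtain ⟨hx1, hx2⟩ := mul_ne_zero_iff.mp hx
    have hx3 : ∀ i j : Fin n, (j : ℕ) = i + s → FreeAlgebra.lift K (triOf x) (q c) i j ≠ 0 := by
      intro i j hij
      have := Finset.prod_ne_zero_iff.mp (Finset.prod_ne_zero_iff.mp hx2 i (by simp)) j (by simp)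
      rw [if_pos hij, hQ] at this
      exact this
    obtain ⟨w, hw⟩ := exists_row (s := s) (FreeAlgebra.lift K (triOf x) (q c))
      (fun i j hij => hqid.vanish _ (triOf_tri x) i j hij) hx3
      (fun j => if h : s ≤ (j : ℕ) then v ⟨(0, j.succ), by simp; omega⟩ else 0)
    refine ⟨blk w (triOf x), blk_tri w _ (triOf_tri x), ?_⟩
    rw [hG1, hf'] at hx1
    convert hx1 using 3
    funext y
    obtain ⟨b1, b2⟩ := blk_eval w (triOf x)
    obtain ⟨⟨i, j⟩, hy⟩ := y
    dsimp only at hy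
    obtain ⟨j, rfl⟩ : ∃ j', j = Fin.succ j' :=
      Fin.exists_succ_eq.mpr (by rintro rfl; simp at hy) |>.imp fun _ h => h.symm
    refine Fin.cases ?_ (fun i => ?_) i hy
    · intro hy
      have hsj : s ≤ (j : ℕ) := by simp at hy; omega
      have hs : sub ⟨(0, j.succ), hy⟩ = MvPolynomial.C (v ⟨(0, j.succ), hy⟩) := dif_pos rfl
      rw [hs, MvPolynomial.eval_C]
      rw [b2, hw j hsj, dif_pos hsj]
    · intro hy
      simp only [sub, Fin.val_succ, Nat.succ_ne_zero, dite_false, MvPolynomial.eval_X, b1]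
      rfl

end

/-- **Main theorem (Theorem 1.3).**
Let `n ≥ 2`, `m ≥ 1`, `K` an algebraically closed field, and let `p` be a polynomial
with zero constant term in the free algebra `K⟨x_1,…,x_m⟩` (zero constant term is
expressed by saying that evaluating all variables at `0 ∈ K` gives `0`).
Suppose `ord(p) = r`, i.e. `p` is a polynomial identity of `T_r(K)` but not of
`T_{r+1}(K)`, and `1 < r < n − 1`.  Then the image `p(T_n(K))` is Zariski-dense in
`T_n(K)^{(r−1)}`: every polynomial `f` in the coordinates of `T_n(K)^{(r−1)}`
(indexed by the positions `(i,j)` with `j − i ≥ r`, 0-indexed) that vanishes on the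
image of `p` vanishes at every point of the affine space `T_n(K)^{(r−1)}`. -/
theorem image_dense_in_Tn_r_minus_one
    (K : Type*) [Field K] [IsAlgClosed K] (n m r : ℕ) (hn : 2 ≤ n) (hm : 1 ≤ m)
    (p : FreeAlgebra K (Fin m))
    (hconst : FreeAlgebra.lift K (fun _ : Fin m => (0 : K)) p = 0)
    (hidr : ∀ u : Fin m → Matrix (Fin r) (Fin r) K,
      (∀ i, (u i).BlockTriangular id) → FreeAlgebra.lift K u p = 0)
    (hidr1 : ¬ ∀ u : Fin m → Matrix (Fin (r + 1)) (Fin (r + 1)) K,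
      (∀ i, (u i).BlockTriangular id) → FreeAlgebra.lift K u p = 0)
    (hr1 : 1 < r) (hr2 : r < n - 1)
    (f : MvPolynomial {q : Fin n × Fin n // (q.1 : ℕ) + r ≤ (q.2 : ℕ)} K)
    (hf : ∀ u : Fin m → Matrix (Fin n) (Fin n) K, (∀ i, (u i).BlockTriangular id) →
      MvPolynomial.eval (fun q => (FreeAlgebra.lift K u p) q.1.1 q.1.2) f = 0) :
    ∀ v : {q : Fin n × Fin n // (q.1 : ℕ) + r ≤ (q.2 : ℕ)} → K,
      MvPolynomial.eval v f = 0 := by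
  intro v
  by_contra hv
  have : Infinite K := inferInstance
  obtain ⟨s, rfl⟩ : ∃ s, r = s + 1 := ⟨r - 1, by omega⟩
  obtain ⟨u, hu, hne⟩ := dense_aux s p hidr hidr1 n f v hv
  exact hne (hf u hu)
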